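/- Fix κ = (κ₀, κ₁, κ_t, κ_∞) ∈ ℂ⁴ and set ρ = (1 − κ₀ − κ₁ − κ_t − κ_∞)/2. Let U ⊆ ℂ∖{0,1} be open and let (q,p) : U → ℂ² be differentiable, solving the Hamiltonian system HS(κ) with q(t) ∉ {0, 1, t} and p(t) ≠ 0 for all t ∈ U, and assume q(t) + ρ/p(t) ∉ {0, 1, t} for all t ∈ U. Then the pair (q̃, p̃) := (q + ρ/p, p) solves the Hamiltonian system HS(κ̃) for the shifted parameters κ̃ = (κ₀ + ρ, κ₁ + ρ, κ_t + ρ, κ_∞ + ρ). (This is the Okamoto symmetry s₂.) -/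

import Mathlib

noncomputable section

/-- The auxiliary parameter ρ = (1 − κ₀ − κ₁ − κ_t − κ_∞)/2. -/
def pvRho (κ0 κ1 κt κinf : ℂ) : ℂ := (1 - κ0 - κ1 - κt - κinf) / 2

/-- The Painlevé VI Hamiltonian
H(t,q,p) = [q(q−1)(q−t)/(t(t−1))]·(p² − (κ₀/q + κ₁/(q−1) + (κ_t−1)/(q−t))p
             + ρ(κ_∞+ρ)/(q(q−1))). -/
def pvH (κ0 κ1 κt κinf t q p : ℂ) : ℂ :=
  q * (q - 1) * (q - t) / (t * (t - 1)) *
    (p ^ 2 - (κ0 / q + κ1 / (q - 1) + (κt - 1) / (q - t)) * p +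
      pvRho κ0 κ1 κt κinf * (κinf + pvRho κ0 κ1 κt κinf) / (q * (q - 1)))

/-- Partial derivative ∂H/∂p of the Hamiltonian. -/
def pvHp (κ0 κ1 κt κinf t q p : ℂ) : ℂ := deriv (fun x => pvH κ0 κ1 κt κinf t q x) p

/-- Partial derivative ∂H/∂q of the Hamiltonian. -/
def pvHq (κ0 κ1 κt κinf t q p : ℂ) : ℂ := deriv (fun x => pvH κ0 κ1 κt κinf t x p) q

/-- `(q, p)` solves the non-autonomous Hamiltonian system
q' = ∂H/∂p, p' = −∂H/∂q on `U`. -/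
def IsHamiltonianSol (κ0 κ1 κt κinf : ℂ) (U : Set ℂ) (q p : ℂ → ℂ) : Prop :=
  ∀ t ∈ U,
    HasDerivAt q (pvHp κ0 κ1 κt κinf t (q t) (p t)) t ∧
    HasDerivAt p (-pvHq κ0 κ1 κt κinf t (q t) (p t)) t

/-- `lam` solves the Painlevé VI equation with parameters `(κ0, κ1, κt, κinf)` on `U`:
it avoids `0`, `1`, `t`, is twice differentiable, and satisfies the PVI ODE. -/
def IsPainleveVISol (κ0 κ1 κt κinf : ℂ) (U : Set ℂ) (lam : ℂ → ℂ) : Prop :=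
  ∀ t ∈ U,
    lam t ≠ 0 ∧ lam t ≠ 1 ∧ lam t ≠ t ∧
    DifferentiableAt ℂ lam t ∧ DifferentiableAt ℂ (deriv lam) t ∧
    deriv (deriv lam) t =
      1 / 2 * (1 / lam t + 1 / (lam t - 1) + 1 / (lam t - t)) * (deriv lam t) ^ 2
        - (1 / t + 1 / (t - 1) + 1 / (lam t - t)) * deriv lam t
        + lam t * (lam t - 1) * (lam t - t) / (t ^ 2 * (t - 1) ^ 2) *
            (κinf ^ 2 / 2 - κ0 ^ 2 / 2 * (t / (lam t) ^ 2)
              + κ1 ^ 2 / 2 * ((t - 1) / (lam t - 1) ^ 2)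
              + (1 - κt ^ 2) / 2 * (t * (t - 1) / (lam t - t) ^ 2))

/-- The Hamiltonian in polynomial form, away from the poles of its coefficients. -/
theorem pvH_eq_polynomial (κ0 κ1 κt κinf t p : ℂ) {q : ℂ}
    (h0 : q ≠ 0) (h1 : q ≠ 1) (ht : q ≠ t) :
    pvH κ0 κ1 κt κinf t q p =
      (q * (q - 1) * (q - t) * p ^ 2 -
        (κ0 * ((q - 1) * (q - t)) + κ1 * (q * (q - t)) + (κt - 1) * (q * (q - 1))) * p +
        pvRho κ0 κ1 κt κinf * (κinf + pvRho κ0 κ1 κt κinf) * (q - t)) / (t * (t - 1)) := by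
  have h1' : q - 1 ≠ 0 := sub_ne_zero.mpr h1
  have ht' : q - t ≠ 0 := sub_ne_zero.mpr ht
  unfold pvH
  rw [div_mul_eq_mul_div]
  congr 1
  field_simp

theorem pvHp_eq (κ0 κ1 κt κinf t p : ℂ) {q : ℂ} (h0 : q ≠ 0) (h1 : q ≠ 1) (ht : q ≠ t) :
    pvHp κ0 κ1 κt κinf t q p =
      (2 * q * (q - 1) * (q - t) * p -
        (κ0 * ((q - 1) * (q - t)) + κ1 * (q * (q - t)) + (κt - 1) * (q * (q - 1)))) /
        (t * (t - 1)) := by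
  unfold pvHp
  rw [funext fun x => pvH_eq_polynomial κ0 κ1 κt κinf t x h0 h1 ht]
  refine HasDerivAt.deriv ?_
  have hid := hasDerivAt_id' p
  refine ((((hid.pow 2).const_mul (q * (q - 1) * (q - t))).sub
    (hid.const_mul _)).add_const _).div_const _ |>.congr_deriv ?_
  push_cast
  ring

theorem pvHq_eq (κ0 κ1 κt κinf t p : ℂ) {q : ℂ} (h0 : q ≠ 0) (h1 : q ≠ 1) (ht : q ≠ t) :
    pvHq κ0 κ1 κt κinf t q p =
      (((q - 1) * (q - t) + q * (q - t) + q * (q - 1)) * p ^ 2 -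
        (κ0 * (2 * q - 1 - t) + κ1 * (2 * q - t) + (κt - 1) * (2 * q - 1)) * p +
        pvRho κ0 κ1 κt κinf * (κinf + pvRho κ0 κ1 κt κinf)) / (t * (t - 1)) := by
  unfold pvHq
  have heq := (eventually_ne_nhds h0).and ((eventually_ne_nhds h1).and (eventually_ne_nhds ht))
    |>.mono fun x hx => pvH_eq_polynomial κ0 κ1 κt κinf t p hx.1 hx.2.1 hx.2.2
  rw [Filter.EventuallyEq.deriv_eq heq]
  refine HasDerivAt.deriv ?_
  have hid := hasDerivAt_id' q
  have hid1 := hid.sub_const 1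
  have hidt := hid.sub_const t
  refine (((((hid.mul hid1).mul hidt).mul_const (p ^ 2)).sub
    (((((hid1.mul hidt).const_mul κ0).add ((hid.mul hidt).const_mul κ1)).add
      ((hid.mul hid1).const_mul (κt - 1))).mul_const p)).add
    (hidt.const_mul _)).div_const _ |>.congr_deriv ?_
  simp only [Pi.mul_apply]
  ring

/-- The shift of the parameters by `ρ` changes the sign of `ρ`. -/
theorem pvRho_add_pvRho (κ0 κ1 κt κinf : ℂ) :
    pvRho (κ0 + pvRho κ0 κ1 κt κinf) (κ1 + pvRho κ0 κ1 κt κinf)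
      (κt + pvRho κ0 κ1 κt κinf) (κinf + pvRho κ0 κ1 κt κinf) = -pvRho κ0 κ1 κt κinf := by
  unfold pvRho
  ring

/-!
STATEMENT 13: If (q,p) is a differentiable solution of the Hamiltonian system HS(κ) on an
open set U ⊆ ℂ∖{0,1}, with q(t) ∉ {0,1,t}, p(t) ≠ 0 and q(t) + ρ/p(t) ∉ {0,1,t} on U, then
(q + ρ/p, p) solves the Hamiltonian system HS(κ₀+ρ, κ₁+ρ, κ_t+ρ, κ_∞+ρ).
(Okamoto symmetry s₂.)
-/

theorem okamoto_symmetry_s2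
    (κ0 κ1 κt κinf : ℂ) (U : Set ℂ) (hU : IsOpen U)
    (hU01 : ∀ t ∈ U, t ≠ 0 ∧ t ≠ 1)
    (q p : ℂ → ℂ)
    (hsol : IsHamiltonianSol κ0 κ1 κt κinf U q p)
    (hreg : ∀ t ∈ U, q t ≠ 0 ∧ q t ≠ 1 ∧ q t ≠ t)
    (hpne : ∀ t ∈ U, p t ≠ 0)
    (hregnew : ∀ t ∈ U,
      q t + pvRho κ0 κ1 κt κinf / p t ≠ 0 ∧
      q t + pvRho κ0 κ1 κt κinf / p t ≠ 1 ∧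
      q t + pvRho κ0 κ1 κt κinf / p t ≠ t) :
    IsHamiltonianSol (κ0 + pvRho κ0 κ1 κt κinf) (κ1 + pvRho κ0 κ1 κt κinf)
      (κt + pvRho κ0 κ1 κt κinf) (κinf + pvRho κ0 κ1 κt κinf) U
      (fun t => q t + pvRho κ0 κ1 κt κinf / p t) p := by
  intro t htU
  obtain ⟨ht0, ht1⟩ := hU01 t htU
  obtain ⟨hq, hp⟩ := hsol t htU
  obtain ⟨h0, h1, ht⟩ := hreg t htU
  obtain ⟨g0, g1, gt⟩ := hregnew t htU
  have hpt := hpne t htU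
  have ht1' : t - 1 ≠ 0 := sub_ne_zero.mpr ht1
  have hκ : κinf = 1 - κ0 - κ1 - κt - 2 * pvRho κ0 κ1 κt κinf := by
    unfold pvRho
    ring
  rw [pvHp_eq _ _ _ _ _ _ h0 h1 ht] at hq
  rw [pvHq_eq _ _ _ _ _ _ h0 h1 ht] at hp
  rw [pvHp_eq _ _ _ _ _ _ g0 g1 gt, pvHq_eq _ _ _ _ _ _ g0 g1 gt, pvRho_add_pvRho]
  generalize pvRho κ0 κ1 κt κinf = ρ at *
  subst hκ
  constructor
  · refine (hq.add ((hasDerivAt_const t ρ).div hp hpt)).congr_deriv ?_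
    field_simp
    ring
  · refine hp.congr_deriv ?_
    field_simp
    ring
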